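/- Let F be a field, A an abelian group (written additively), and s : F^× × F^× → A a Steinberg symbol. Let α, β ∈ F with α ≠ 0, α ≠ 1, β ≠ 0, β ≠ 1 and αβ ≠ α − 1 (so that 1−α, 1−β, α(1−β) and 1 − (1−α^{−1})^{−1}β are all nonzero). Then s(1−α, 1−β) = s(α(1−β), 1 − (1−α^{−1})^{−1}β). -/

import Mathlib

/-- A Steinberg symbol vanishes on pairs `(x, -x)`. -/
theorem steinberg_symbol_self_neg {F A : Type*} [Field F] [AddCommGroup A] {s : F → F → A}
    (hleft : ∀ x y z : F, x ≠ 0 → y ≠ 0 → z ≠ 0 → s (x * y) z = s x z + s y z)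
    (hright : ∀ x y z : F, x ≠ 0 → y ≠ 0 → z ≠ 0 → s x (y * z) = s x y + s x z)
    (hst : ∀ x : F, x ≠ 0 → x ≠ 1 → s x (1 - x) = 0) {x : F} (hx : x ≠ 0) :
    s x (-x) = 0 := by
  have one_left : ∀ z : F, z ≠ 0 → s 1 z = 0 := fun z hz => by
    simpa using hleft 1 1 z one_ne_zero one_ne_zero hz
  by_cases hx1 : x = 1
  · subst hx1
    exact one_left _ (neg_ne_zero.mpr one_ne_zero)
  have hinv : x⁻¹ ≠ 1 := by simpa using hx1
  have hsub : 1 - x⁻¹ ≠ 0 := sub_ne_zero.mpr hinv.symm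
  have h₁ := hleft x x⁻¹ (1 - x⁻¹) hx (inv_ne_zero hx) hsub
  rw [mul_inv_cancel₀ hx, one_left _ hsub, hst _ (inv_ne_zero hx) hinv, add_zero] at h₁
  have h₂ := hright x (-x) (1 - x⁻¹) hx (neg_ne_zero.mpr hx) hsub
  have hmul : -x * (1 - x⁻¹) = 1 - x := by
    field_simp
    ring
  rw [hmul, hst x hx hx1, ← h₁, add_zero] at h₂
  exact h₂.symm

/-- A Steinberg symbol is skew-symmetric. -/
theorem steinberg_symbol_add_swap {F A : Type*} [Field F] [AddCommGroup A] {s : F → F → A}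
    (hleft : ∀ x y z : F, x ≠ 0 → y ≠ 0 → z ≠ 0 → s (x * y) z = s x z + s y z)
    (hright : ∀ x y z : F, x ≠ 0 → y ≠ 0 → z ≠ 0 → s x (y * z) = s x y + s x z)
    (hst : ∀ x : F, x ≠ 0 → x ≠ 1 → s x (1 - x) = 0) {x y : F} (hx : x ≠ 0) (hy : y ≠ 0) :
    s x y + s y x = 0 := by
  have hxy := mul_ne_zero hx hy
  have h := steinberg_symbol_self_neg hleft hright hst hxy
  have hx' : -(x * y) = -x * y := by ring
  have hy' : -(x * y) = -y * x := by ring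
  rwa [hleft x y _ hx hy (neg_ne_zero.mpr hxy), hx', hright x (-x) y hx (neg_ne_zero.mpr hx) hy,
    ← hx', hy', hright y (-y) x hy (neg_ne_zero.mpr hy) hx,
    steinberg_symbol_self_neg hleft hright hst hx,
    steinberg_symbol_self_neg hleft hright hst hy, zero_add, zero_add] at h


/-- **Steinberg symbol identity** (Well-known Lemma 0.4.1 of Zhukov,
"On ramification theory in the imperfect residue field case").

Let `F` be a field, `A` an additively written abelian group, and `s` a Steinberg
symbol on `F` with values in `A`, i.e. `s` is biadditive (with respect to
multiplication of nonzero field elements) and satisfies `s x (1 - x) = 0` for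
`x ≠ 0, 1`.  If `α, β ∈ F` satisfy `α ≠ 0`, `α ≠ 1`, `β ≠ 0`, `β ≠ 1` and
`α * β ≠ α - 1`, then
`s (1 - α) (1 - β) = s (α * (1 - β)) (1 - (1 - α⁻¹)⁻¹ * β)`. -/
theorem steinberg_symbol_identity
    (F : Type*) [Field F] (A : Type*) [AddCommGroup A]
    (s : F → F → A)
    (hleft : ∀ x y z : F, x ≠ 0 → y ≠ 0 → z ≠ 0 → s (x * y) z = s x z + s y z)
    (hright : ∀ x y z : F, x ≠ 0 → y ≠ 0 → z ≠ 0 → s x (y * z) = s x y + s x z)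
    (hst : ∀ x : F, x ≠ 0 → x ≠ 1 → s x (1 - x) = 0)
    (α β : F) (hα0 : α ≠ 0) (hα1 : α ≠ 1) (hβ0 : β ≠ 0) (hβ1 : β ≠ 1)
    (h : α * β ≠ α - 1) :
    s (1 - α) (1 - β) = s (α * (1 - β)) (1 - (1 - α⁻¹)⁻¹ * β) := by
  have hα : 1 - α ≠ 0 := sub_ne_zero.mpr hα1.symm
  have hβ : 1 - β ≠ 0 := sub_ne_zero.mpr hβ1.symm
  have hγ0 : α * (1 - β) ≠ 0 := mul_ne_zero hα0 hβ
  have hγ1 : α * (1 - β) ≠ 1 := fun h' => h (by linear_combination -h')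
  have hmul : (1 - (1 - α⁻¹)⁻¹ * β) * (1 - α) = 1 - α * (1 - β) := by
    have hinv : (1 - α⁻¹)⁻¹ * (1 - α) = -α := by
      have hsub : 1 - α⁻¹ ≠ 0 := sub_ne_zero.mpr (by simpa using hα1)
      rw [inv_mul_eq_iff_eq_mul₀ hsub]
      field_simp
      ring
    linear_combination -β * hinv
  have hD : 1 - (1 - α⁻¹)⁻¹ * β ≠ 0 := by
    refine left_ne_zero_of_mul (b := 1 - α) ?_
    rw [hmul]
    exact sub_ne_zero.mpr hγ1.symm
  have h₁ := hright (α * (1 - β)) _ (1 - α) hγ0 hD hα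
  rw [hmul, hst _ hγ0 hγ1, hleft α (1 - β) (1 - α) hα0 hβ hα, hst α hα0 hα1, zero_add] at h₁
  exact add_right_cancel ((steinberg_symbol_add_swap hleft hright hst hα hβ).trans h₁)
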